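/- Let f be in the class F and let y_0,...,y_N, x_0,...,x_N be generated by OGM-OG, and set y_{N+1} = x_N − (1/L)∇f(x_N). Then f(y_{N+1}) − f(x_*) ≤ 2·L·R² / (N+2)². -/

import Mathlib

theorem hasDerivAt_comp_line {E : Type*} [NormedAddCommGroup E] [InnerProductSpace ℝ E]
    [CompleteSpace E] {f : E → ℝ} {f' : E → E} (hdiff : ∀ z, HasGradientAt f (f' z) z)
    (z v : E) (s : ℝ) :
    HasDerivAt (fun s : ℝ => f (z + s • v)) (inner ℝ (f' (z + s • v)) v) s := by
  have hline : HasDerivAt (fun s : ℝ => z + s • v) v s := by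
    simpa using ((hasDerivAt_id s).smul_const v).const_add z
  simpa [Function.comp_def] using
    (hdiff (z + s • v)).hasFDerivAt.comp_hasDerivAt s hline

/-- The descent lemma for functions with Lipschitz gradient. -/
theorem le_quadratic_of_lipschitz_gradient {E : Type*} [NormedAddCommGroup E]
    [InnerProductSpace ℝ E] [CompleteSpace E] {f : E → ℝ} {f' : E → E} {L : ℝ}
    (hdiff : ∀ z, HasGradientAt f (f' z) z)
    (hlip : ∀ z w, ‖f' z - f' w‖ ≤ L * ‖z - w‖) (z w : E) :
    f w ≤ f z + inner ℝ (f' z) (w - z) + L / 2 * ‖w - z‖ ^ 2 := by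
  set v := w - z with hv
  have hder : ∀ s : ℝ, HasDerivAt
      (fun s : ℝ => f (z + s • v) - s * inner ℝ (f' z) v - s ^ 2 * (L / 2 * ‖v‖ ^ 2))
      (inner ℝ (f' (z + s • v)) v - inner ℝ (f' z) v - 2 * s * (L / 2 * ‖v‖ ^ 2)) s := by
    intro s
    have h := ((hasDerivAt_comp_line hdiff z v s).sub
      ((hasDerivAt_id s).mul_const (inner ℝ (f' z) v))).sub
      (((hasDerivAt_id s).pow 2).mul_const (L / 2 * ‖v‖ ^ 2))
    refine (h.congr_deriv (by simp)).congr_of_eventuallyEq (.of_forall fun s => ?_)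
    simp
  have hanti := antitoneOn_of_deriv_nonpos (convex_Icc (0 : ℝ) 1)
    (fun s _ => (hder s).continuousAt.continuousWithinAt)
    (fun s _ => (hder s).differentiableAt.differentiableWithinAt)
    (fun s hs => by
      rw [interior_Icc] at hs
      rw [(hder s).deriv, ← inner_sub_left]
      have hcs := real_inner_le_norm (f' (z + s • v) - f' z) v
      have hl := hlip (z + s • v) z
      rw [add_sub_cancel_left, norm_smul, Real.norm_of_nonneg hs.1.le] at hl
      nlinarith [mul_le_mul_of_nonneg_right hl (norm_nonneg v)])
  have h := hanti (Set.left_mem_Icc.2 zero_le_one) (Set.right_mem_Icc.2 zero_le_one) zero_le_one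
  have hw : z + v = w := by simp [hv]
  simp [hw] at h
  linarith

/-- A differentiable convex function lies above its tangent hyperplanes. -/
theorem ConvexOn.inner_gradient_le {E : Type*} [NormedAddCommGroup E]
    [InnerProductSpace ℝ E] [CompleteSpace E] {f : E → ℝ} {f' : E → E}
    (hconv : ConvexOn ℝ Set.univ f) (hdiff : ∀ z, HasGradientAt f (f' z) z) (z w : E) :
    f z + inner ℝ (f' z) (w - z) ≤ f w := by
  have hc : ConvexOn ℝ Set.univ (fun s : ℝ => f (z + s • (w - z))) := by
    have h := hconv.comp_affineMap (AffineMap.lineMap z w : ℝ →ᵃ[ℝ] E)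
    simpa [Function.comp_def, AffineMap.lineMap_apply, add_comm] using h
  have hd := hasDerivAt_comp_line hdiff z (w - z) 0
  have h := hc.le_slope_of_hasDerivAt (Set.mem_univ 0) (Set.mem_univ 1) zero_lt_one hd
  simp [slope_def_field] at h
  linarith

/-- Strengthened gradient inequality for smooth convex functions. -/
theorem ConvexOn.inner_gradient_add_norm_sq_le {E : Type*} [NormedAddCommGroup E]
    [InnerProductSpace ℝ E] [CompleteSpace E] {f : E → ℝ} {f' : E → E} {L : ℝ} (hL : 0 < L)
    (hconv : ConvexOn ℝ Set.univ f) (hdiff : ∀ z, HasGradientAt f (f' z) z)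
    (hlip : ∀ z w, ‖f' z - f' w‖ ≤ L * ‖z - w‖) (z w : E) :
    f z + inner ℝ (f' z) (w - z) + 1 / (2 * L) * ‖f' w - f' z‖ ^ 2 ≤ f w := by
  set g := f' w - f' z with hg
  have hlow := hconv.inner_gradient_le hdiff z (w - (1 / L) • g)
  have hup := le_quadratic_of_lipschitz_gradient hdiff hlip w (w - (1 / L) • g)
  have hsplit : inner ℝ (f' z) (w - (1 / L) • g - z)
      = inner ℝ (f' z) (w - z) - 1 / L * inner ℝ (f' z) g := by
    rw [sub_right_comm, inner_sub_right, real_inner_smul_right]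
  have hself : inner ℝ (f' w) g - inner ℝ (f' z) g = ‖g‖ ^ 2 := by
    rw [← inner_sub_left, ← hg, real_inner_self_eq_norm_sq]
  rw [hsplit] at hlow
  rw [sub_sub_cancel_left, inner_neg_right, real_inner_smul_right, norm_neg, norm_smul,
    Real.norm_of_nonneg (by positivity)] at hup
  have hq : L / 2 * (1 / L * ‖g‖) ^ 2 = 1 / (2 * L) * ‖g‖ ^ 2 := by field_simp
  have hr : 1 / L * (inner ℝ (f' w) g - inner ℝ (f' z) g) = 2 * (1 / (2 * L) * ‖g‖ ^ 2) := by
    rw [hself]; field_simp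
  linarith

/-- One-step decrease of the potential of the generalized optimized gradient method. -/
theorem gogm_potential_step {E : Type*} [NormedAddCommGroup E]
    [InnerProductSpace ℝ E] [CompleteSpace E] {f : E → ℝ} {f' : E → E} {L : ℝ} (hL : 0 < L)
    (hconv : ConvexOn ℝ Set.univ f) (hdiff : ∀ z, HasGradientAt f (f' z) z)
    (hlip : ∀ z w, ‖f' z - f' w‖ ≤ L * ‖z - w‖) {xs : E} (hxs : f' xs = 0)
    {T t : ℝ} (hT : 0 ≤ T) (ht : 0 ≤ t) (htT : t ^ 2 ≤ T + t) {u v z : E}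
    (hv : (T + t) • v = T • (u - (1 / L) • f' u) + t • z) :
    2 * (T + t) * (f v - f xs - 1 / (2 * L) * ‖f' v‖ ^ 2)
        + L / 2 * ‖z - (2 * t / L) • f' v - xs‖ ^ 2
      ≤ 2 * T * (f u - f xs - 1 / (2 * L) * ‖f' u‖ ^ 2) + L / 2 * ‖z - xs‖ ^ 2 := by
  have ha := hconv.inner_gradient_add_norm_sq_le hL hdiff hlip v u
  have hb := hconv.inner_gradient_add_norm_sq_le hL hdiff hlip v xs
  rw [norm_sub_sq_real, inner_sub_right] at ha
  rw [hxs, zero_sub, norm_neg, inner_sub_right] at hb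
  have hinner := congrArg (inner ℝ (f' v)) hv
  rw [inner_add_right, real_inner_smul_right, real_inner_smul_right, real_inner_smul_right,
    inner_sub_right, real_inner_smul_right] at hinner
  rw [real_inner_comm (f' v) (f' u)] at ha
  have hz : ‖z - (2 * t / L) • f' v - xs‖ ^ 2 = ‖z - xs‖ ^ 2
      - 2 * (2 * t / L) * (inner ℝ (f' v) z - inner ℝ (f' v) xs)
      + (2 * t / L) ^ 2 * ‖f' v‖ ^ 2 := by
    rw [sub_right_comm, norm_sub_sq_real, real_inner_smul_right, norm_smul, mul_pow,
      Real.norm_eq_abs, sq_abs, real_inner_comm, inner_sub_right]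
    ring
  have hquad (a b c : ℝ) : L / 2 * (a - 2 * (2 * t / L) * b + (2 * t / L) ^ 2 * c)
      = L / 2 * a - 2 * t * b + t ^ 2 * (2 * (1 / L) * c) := by
    field_simp
  rw [hz, hquad]
  rw [show 1 / (2 * L) = 1 / L / 2 by ring] at *
  have ha' := mul_le_mul_of_nonneg_left ha (by positivity : 0 ≤ 2 * T)
  have hb' := mul_le_mul_of_nonneg_left hb (by positivity : 0 ≤ 2 * t)
  have hc' := mul_le_mul_of_nonneg_right htT (by positivity : 0 ≤ 2 * (1 / L) * ‖f' v‖ ^ 2)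
  generalize 1 / L = c at *
  linarith

/-- The rate of the generalized optimized gradient method in terms of the final sum of weights. -/
theorem gogm_rate {E : Type*} [NormedAddCommGroup E]
    [InnerProductSpace ℝ E] [CompleteSpace E] {f : E → ℝ} {f' : E → E} {L : ℝ} (hL : 0 < L)
    (hconv : ConvexOn ℝ Set.univ f) (hdiff : ∀ z, HasGradientAt f (f' z) z)
    (hlip : ∀ z w, ‖f' z - f' w‖ ≤ L * ‖z - w‖) {xs : E} (hxs : f' xs = 0)
    {N : ℕ} {t T : ℕ → ℝ} (ht0 : t 0 = 1) (hT0 : T 0 = 1)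
    (hTs : ∀ i, T (i + 1) = T i + t (i + 1))
    (htpos : ∀ i, i ≤ N → 0 < t i) (htT : ∀ i, i ≤ N → t i ^ 2 ≤ T i)
    {x y : ℕ → E}
    (hy : ∀ i, i ≤ N → y (i + 1) = x i - (1 / L) • f' (x i))
    (hx : ∀ i, i < N → x (i + 1) = y (i + 1)
        + ((T i - t i) * t (i + 1) / (t i * T (i + 1))) • (y (i + 1) - y i)
        + ((2 * t i ^ 2 - T i) * t (i + 1) / (t i * T (i + 1))) • (y (i + 1) - x i)) :
    T N * (f (y (N + 1)) - f xs) ≤ L / 4 * ‖x 0 - xs‖ ^ 2 := by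
  set z : ℕ → E := fun i => x 0 - ∑ l ∈ Finset.range i, (2 * t l / L) • f' (x l) with hz
  have hzs (i : ℕ) : z (i + 1) = z i - (2 * t i / L) • f' (x i) := by
    simp only [hz, Finset.sum_range_succ]
    abel
  have hTpos (i : ℕ) (hi : i ≤ N) : 0 < T i := (pow_pos (htpos i hi) 2).trans_le (htT i hi)
  have hmix : ∀ k, k ≤ N → T k • x k = (T k - t k) • y k + t k • z k := by
    intro k
    induction k with
    | zero => simp [ht0, hT0, hz]
    | succ k ih =>
      intro hk
      have hk' : k ≤ N := by omega
      have htk := htpos k hk'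
      have hTk := hTpos (k + 1) hk
      have hzk : z k = (t k)⁻¹ • (T k • x k - (T k - t k) • y k) := by
        rw [ih hk', add_sub_cancel_left, inv_smul_smul₀ htk.ne']
      have hgk : (2 * t k / L) • f' (x k) = (2 * t k) • (x k - y (k + 1)) := by
        rw [hy k hk', sub_sub_cancel, smul_smul]
        ring_nf
      rw [hzs, hzk, hgk, hx k hk]
      match_scalars <;> field_simp <;> ring
  have hpot : ∀ k, k ≤ N → 2 * T k * (f (x k) - f xs - 1 / (2 * L) * ‖f' (x k)‖ ^ 2)
      + L / 2 * ‖z (k + 1) - xs‖ ^ 2 ≤ L / 2 * ‖x 0 - xs‖ ^ 2 := by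
    intro k
    induction k with
    | zero =>
      intro _
      have h := gogm_potential_step hL hconv hdiff hlip hxs le_rfl zero_le_one
        (by norm_num : (1 : ℝ) ^ 2 ≤ 0 + 1) (u := x 0) (v := x 0) (z := x 0) (by simp)
      rw [hzs]
      simpa [hT0, ht0, hz] using h
    | succ k ih =>
      intro hk
      have hk' : k ≤ N := by omega
      have hstep := hmix (k + 1) hk
      have hle := htT (k + 1) hk
      rw [hTs, add_sub_cancel_right, hy k hk'] at hstep
      rw [hTs] at hle
      have h := gogm_potential_step hL hconv hdiff hlip hxs (hTpos k hk').le (htpos (k + 1) hk).le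
        hle hstep
      rw [hzs, hTs]
      exact h.trans (ih hk')
  have hfin := hpot N le_rfl
  have hdesc := le_quadratic_of_lipschitz_gradient hdiff hlip (x N) (y (N + 1))
  rw [hy N le_rfl, sub_sub_cancel_left, inner_neg_right, real_inner_smul_right, norm_neg,
    norm_smul, Real.norm_of_nonneg (by positivity), real_inner_self_eq_norm_sq, ← hy N le_rfl]
    at hdesc
  have hcomb : -(1 / L * ‖f' (x N)‖ ^ 2) + L / 2 * (1 / L * ‖f' (x N)‖) ^ 2
      = -(1 / (2 * L) * ‖f' (x N)‖ ^ 2) := by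
    field_simp
    ring
  have hval : f (y (N + 1)) - f xs ≤ f (x N) - f xs - 1 / (2 * L) * ‖f' (x N)‖ ^ 2 := by
    linarith
  have hmul := mul_le_mul_of_nonneg_left hval (hTpos N le_rfl).le
  have hnn : 0 ≤ L / 2 * ‖z (N + 1) - xs‖ ^ 2 := by positivity
  linarith

/-- Properties of the OGM-OG parameters. -/
theorem ogm_og_parameters {N m : ℕ} (hm : m = (N + 1) / 2) (hN : 0 < N)
    {t T : ℕ → ℝ} (ht0 : t 0 = 1)
    (htrec : ∀ i, i + 2 ≤ m → t (i + 1) = (1 + Real.sqrt (1 + 4 * t i ^ 2)) / 2)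
    (htlin : ∀ i, m ≤ i → i ≤ N → t i = ((N : ℝ) - (i : ℝ) + 1) / 2)
    (hT0 : T 0 = 1) (hTs : ∀ i, T (i + 1) = T i + t (i + 1)) :
    (∀ i, i ≤ N → 0 < t i) ∧ (∀ i, i ≤ N → t i ^ 2 ≤ T i) ∧ ((N : ℝ) + 2) ^ 2 / 8 ≤ T N := by
  have hinit : ∀ i, i + 1 ≤ m → ((i : ℝ) + 2) / 2 ≤ t i ∧ T i = t i ^ 2 := by
    intro i
    induction i with
    | zero => intro _; simp [ht0, hT0]
    | succ i ih =>
      intro hi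
      obtain ⟨hlow, hsq⟩ := ih (by omega)
      have hpos : 0 < t i := lt_of_lt_of_le (by positivity) hlow
      have hrec := htrec i (by omega)
      have hsqrt : 2 * t i ≤ Real.sqrt (1 + 4 * t i ^ 2) :=
        Real.le_sqrt_of_sq_le (by linarith [mul_pow 2 (t i) 2])
      have hself := Real.sq_sqrt (by positivity : 0 ≤ 1 + 4 * t i ^ 2)
      refine ⟨by push_cast; linarith, ?_⟩
      rw [hTs, hsq, hrec]
      linarith
  obtain ⟨n, rfl⟩ : ∃ n, m = n + 1 := ⟨m - 1, by omega⟩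
  have hNlow : 2 * (n : ℝ) + 1 ≤ N := by exact_mod_cast (by omega : 2 * n + 1 ≤ N)
  have hNup : (N : ℝ) ≤ 2 * n + 2 := by exact_mod_cast (by omega : N ≤ 2 * n + 2)
  obtain ⟨htn, hTn⟩ := hinit n le_rfl
  have hTlow : ∀ j, n + j ≤ N → ((n : ℝ) + 2) ^ 2 / 4
      + (((N : ℝ) - n) * (N - n + 1) - (N - n - j) * (N - n - j + 1)) / 4 ≤ T (n + j) := by
    intro j
    induction j with
    | zero => intro _; simp [hTn]; nlinarith
    | succ j ih =>
      intro hj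
      have h := ih (by omega)
      rw [← add_assoc, hTs, htlin (n + j + 1) (by omega) (by omega)]
      push_cast
      linarith
  have hlate (i : ℕ) (hi : i ≤ N) (hni : n < i) : 0 < t i ∧ t i ^ 2 ≤ T i := by
    obtain ⟨j, rfl⟩ := Nat.exists_eq_add_of_lt hni
    have h := hTlow (j + 1) (by omega)
    have hjN : (n : ℝ) + j + 1 ≤ N := by exact_mod_cast hi
    have hj : (0 : ℝ) ≤ j := j.cast_nonneg
    have htj := htlin (n + j + 1) (by omega) hi
    push_cast at h htj
    refine ⟨by linarith, ?_⟩
    have hsq : t (n + j + 1) ^ 2 ≤ (((n : ℝ) + 2) / 2) ^ 2 :=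
      pow_le_pow_left₀ (by linarith) (by linarith) 2
    rw [← add_assoc] at h
    nlinarith
  have hearly (i : ℕ) (hni : i ≤ n) : 0 < t i ∧ t i ^ 2 ≤ T i := by
    obtain ⟨hlow, hsq⟩ := hinit i (by omega)
    exact ⟨lt_of_lt_of_le (by positivity) hlow, hsq.ge⟩
  have hall (i : ℕ) (hi : i ≤ N) : 0 < t i ∧ t i ^ 2 ≤ T i :=
    (le_or_gt i n).elim (hearly i) (hlate i hi)
  refine ⟨fun i hi => (hall i hi).1, fun i hi => (hall i hi).2, ?_⟩
  have h := hTlow (N - n) (by omega)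
  rw [Nat.add_sub_cancel' (by omega), Nat.cast_sub (by omega)] at h
  nlinarith

theorem stmt_12 {d : ℕ} (L R : ℝ) (hL : 0 < L) (hR : 0 < R)
    (f : EuclideanSpace ℝ (Fin d) → ℝ)
    (f' : EuclideanSpace ℝ (Fin d) → EuclideanSpace ℝ (Fin d))
    (hconv : ConvexOn ℝ Set.univ f)
    (hdiff : ∀ z, HasGradientAt f (f' z) z)
    (hlip : ∀ z w, ‖f' z - f' w‖ ≤ L * ‖z - w‖)
    (xs : EuclideanSpace ℝ (Fin d)) (hmin : ∀ z, f xs ≤ f z)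
    (N m : ℕ) (hm : m = (N + 1) / 2)
    (t T : ℕ → ℝ) (ht0 : t 0 = 1)
    (htrec : ∀ i, i + 2 ≤ m → t (i + 1) = (1 + Real.sqrt (1 + 4 * t i ^ 2)) / 2)
    (htlin : ∀ i, m ≤ i → i ≤ N → t i = ((N : ℝ) - (i : ℝ) + 1) / 2)
    (hT : ∀ i, T i = ∑ l ∈ Finset.range (i + 1), t l)
    (x y : ℕ → EuclideanSpace ℝ (Fin d)) (x0 : EuclideanSpace ℝ (Fin d))
    (hx0 : x 0 = x0) (hy0 : y 0 = x0) (hinit : ‖x0 - xs‖ ≤ R)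
    (hy : ∀ i, i ≤ N → y (i + 1) = x i - (1 / L) • f' (x i))
    (hx : ∀ i, i < N → x (i + 1) = y (i + 1)
        + ((T i - t i) * t (i + 1) / (t i * T (i + 1))) • (y (i + 1) - y i)
        + ((2 * t i ^ 2 - T i) * t (i + 1) / (t i * T (i + 1))) • (y (i + 1) - x i)) :
    f (y (N + 1)) - f xs ≤ 2 * L * R ^ 2 / ((N : ℝ) + 2) ^ 2 := by
  have hxs : f' xs = 0 := by
    have h := (hdiff xs).hasFDerivAt
    exact (InnerProductSpace.toDual ℝ _).map_eq_zero_iff.1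
      ((show IsLocalMin f xs from .of_forall hmin).hasFDerivAt_eq_zero h)
  have hT0 : T 0 = 1 := by simp [hT, ht0]
  have hTs (i : ℕ) : T (i + 1) = T i + t (i + 1) := by rw [hT, hT, Finset.sum_range_succ]
  have hN : 0 < N := by
    rcases Nat.eq_zero_or_pos N with rfl | h
    · have h := htlin 0 (by omega) le_rfl
      norm_num [ht0] at h
    · exact h
  obtain ⟨htpos, htT, hTN⟩ := ogm_og_parameters hm hN ht0 htrec htlin hT0 hTs
  have hrate := gogm_rate hL hconv hdiff hlip hxs ht0 hT0 hTs htpos htT hy hx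
  rw [hx0] at hrate
  have hR2 : ‖x0 - xs‖ ^ 2 ≤ R ^ 2 := pow_le_pow_left₀ (norm_nonneg _) hinit 2
  have hgap : 0 ≤ f (y (N + 1)) - f xs := sub_nonneg.2 (hmin _)
  rw [le_div_iff₀ (by positivity)]
  linarith [mul_le_mul_of_nonneg_right hTN hgap, mul_le_mul_of_nonneg_left hR2 hL.le]
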